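/- Let a ∈ ℝ with a < −1, let m ≥ 0 and j ≥ 0 be integers, and for ξ ∈ ℝⁿ \ {0} define Q_j^{±}(ξ) := ∫₀^∞ e^{±ir} r^{a+m} ψ^{(m)}(r) ∮_ω e^{z^{1/α}} z^{(1−β)/α} (r^{jσ}/|ξ|^{jσ}) (z − e^{iφ} r^σ/|ξ|^σ)^{−(j+1)} dz dr. Then, for each choice of sign: if j ≥ 1, lim_{|ξ|→∞} Q_j^{±}(ξ) = 0; and if j = 0, lim_{|ξ|→∞} Q_0^{±}(ξ) = (∮_ω e^{z^{1/α}} z^{(1−β−α)/α} dz) ∫₀^∞ e^{±ir} r^{a+m} ψ^{(m)}(r) dr. -/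

import Mathlib

open MeasureTheory Filter Real Complex Topology ENNReal

/-- The contour integral `∮_ω F(z) dz` over the contour `C_ω` consisting of the two rays
`{ρ e^{±iω} : ρ ≥ 1}` and the arc `{e^{iθ} : |θ| ≤ ω}`:
`∮_ω F = ∫₁^∞ F(ρe^{iω}) e^{iω} dρ − ∫₁^∞ F(ρe^{−iω}) e^{−iω} dρ + i ∫_{−ω}^{ω} F(e^{iθ}) e^{iθ} dθ`. -/
noncomputable def contourIntegral (ω : ℝ) (F : ℂ → ℂ) : ℂ :=
  (∫ ρ in Set.Ioi (1:ℝ), F ((ρ : ℂ) * Complex.exp (Complex.I * ω)) * Complex.exp (Complex.I * ω))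
  - (∫ ρ in Set.Ioi (1:ℝ),
      F ((ρ : ℂ) * Complex.exp (-(Complex.I) * ω)) * Complex.exp (-(Complex.I) * ω))
  + Complex.I * ∫ θ in (-ω)..ω, F (Complex.exp (Complex.I * θ)) * Complex.exp (Complex.I * θ)

/-- The kernel `z ↦ e^{z^{1/α}} z^{(1−β)/α}`, with principal complex powers. -/
noncomputable def mlKer (a b : ℝ) (z : ℂ) : ℂ :=
  Complex.exp (z ^ (((1 / a : ℝ)) : ℂ)) * z ^ ((((1 - b) / a : ℝ)) : ℂ)

/-- `Q_j^±(ξ)`, the oscillatory integral of Lemma 4.3 of the paper. -/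
noncomputable def Qpm (n : ℕ) (a b s p ω c : ℝ) (cut : ℝ → ℝ) (m j : ℕ) (ε : ℝ)
    (ξ : EuclideanSpace ℝ (Fin n)) : ℂ :=
  ∫ r in Set.Ioi (0:ℝ), Complex.exp ((ε : ℂ) * Complex.I * r) * ((r ^ (c + m) : ℝ) : ℂ) *
    ((iteratedDeriv m (fun t => 1 - cut t) r : ℝ) : ℂ) *
    contourIntegral ω (fun z => mlKer a b z *
      ((r ^ ((j : ℝ) * s) / ‖ξ‖ ^ ((j : ℝ) * s) : ℝ) : ℂ) *
      ((z - Complex.exp (Complex.I * p) * ((r ^ s / ‖ξ‖ ^ s : ℝ) : ℂ)) ^ (j + 1))⁻¹)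

theorem exists_pos_le_norm_sub {φ ω : ℝ} (hφ : |φ| ≤ Real.pi) (hω0 : 0 ≤ ω) (hω : ω < |φ|)
    (hωπ : ω < Real.pi) :
    ∃ c : ℝ, 0 < c ∧ ∀ θ ρ t : ℝ, |θ| ≤ ω → 1 ≤ ρ → 0 ≤ t →
      c ≤ ‖(ρ : ℂ) * Complex.exp (Complex.I * θ) - Complex.exp (Complex.I * φ) * (t : ℂ)‖ ∧
      c * t ≤ ‖(ρ : ℂ) * Complex.exp (Complex.I * θ) - Complex.exp (Complex.I * φ) * (t : ℂ)‖ := by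
  set δ := min (|φ| - ω) (Real.pi - ω) with hδ
  have hδ0 : 0 < δ := lt_min (by linarith) (by linarith)
  have hδ1 : δ ≤ |φ| - ω := min_le_left _ _
  have hδ2 : δ ≤ Real.pi - ω := min_le_right _ _
  have hcosδ : Real.cos δ < 1 := by
    rw [← Real.cos_zero]
    exact Real.cos_lt_cos_of_nonneg_of_le_pi le_rfl (by linarith) hδ0
  set κ := max 0 (Real.cos δ) with hκ
  have hκ0 : 0 ≤ κ := le_max_left _ _
  have hκ1 : 0 < 1 - κ := sub_pos.2 (max_lt one_pos hcosδ)
  refine ⟨√(1 - κ), Real.sqrt_pos.2 hκ1, fun θ ρ t hθ hρ ht => ?_⟩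
  have hcos : Real.cos (θ - φ) ≤ κ := by
    refine le_trans ?_ (le_max_right _ _)
    have h1 : δ ≤ |θ - φ| := by
      have := abs_sub_abs_le_abs_sub φ θ
      rw [abs_sub_comm] at this
      linarith
    have h2 : |θ - φ| ≤ 2 * Real.pi - δ := by
      have := abs_sub θ φ
      linarith
    rw [← Real.cos_abs (θ - φ)]
    rcases le_total |θ - φ| Real.pi with h | h
    · exact Real.cos_le_cos_of_nonneg_of_le_pi hδ0.le h h1
    · rw [← Real.cos_two_pi_sub]
      exact Real.cos_le_cos_of_nonneg_of_le_pi hδ0.le (by linarith) (by linarith)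
  have hsq : (1 - κ) * (ρ ^ 2 + t ^ 2) ≤
      ‖(ρ : ℂ) * Complex.exp (Complex.I * θ) - Complex.exp (Complex.I * φ) * (t : ℂ)‖ ^ 2 := by
    have hnorm : ‖(ρ : ℂ) * Complex.exp (Complex.I * θ) -
        Complex.exp (Complex.I * φ) * (t : ℂ)‖ ^ 2 =
        ρ ^ 2 + t ^ 2 - 2 * (ρ * t) * Real.cos (θ - φ) := by
      rw [← Complex.normSq_eq_norm_sq, Complex.normSq_apply, mul_comm Complex.I, mul_comm Complex.I,
        Real.cos_sub]
      simp only [Complex.sub_re, Complex.sub_im, Complex.re_ofReal_mul, Complex.im_ofReal_mul,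
        Complex.re_mul_ofReal, Complex.im_mul_ofReal, Complex.exp_ofReal_mul_I_re,
        Complex.exp_ofReal_mul_I_im]
      linear_combination ρ ^ 2 * Real.sin_sq_add_cos_sq θ + t ^ 2 * Real.sin_sq_add_cos_sq φ
    rw [hnorm]
    have h1 : ρ * t * Real.cos (θ - φ) ≤ ρ * t * κ :=
      mul_le_mul_of_nonneg_left hcos (by positivity)
    nlinarith [mul_nonneg hκ0 (sq_nonneg (ρ - t))]
  have hs : √(1 - κ) ^ 2 = 1 - κ := Real.sq_sqrt hκ1.le
  constructor
  · refine le_of_sq_le_sq ?_ (norm_nonneg _)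
    rw [hs]
    refine le_trans ?_ hsq
    exact le_mul_of_one_le_right hκ1.le (by nlinarith [sq_nonneg t])
  · refine le_of_sq_le_sq ?_ (norm_nonneg _)
    rw [mul_pow, hs]
    refine le_trans ?_ hsq
    nlinarith [sq_nonneg ρ]

theorem continuousOn_bounded_integral_cauchy_kernel {μ : Measure ℝ} {γ k w : ℝ → ℂ} {e : ℂ} {c : ℝ}
    (j : ℕ) (hc : 0 < c) (hγ : Measurable γ) (hk : Integrable k μ) (hw : Measurable w)
    (hw1 : ∀ x, ‖w x‖ = 1)
    (h : ∀ᵐ x ∂μ, ∀ t : ℝ, 0 ≤ t → c ≤ ‖γ x - e * (t : ℂ)‖ ∧ c * t ≤ ‖γ x - e * (t : ℂ)‖) :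
    ContinuousOn (fun t : ℝ => ∫ x, k x * ((t ^ j : ℝ) : ℂ) *
      ((γ x - e * (t : ℂ)) ^ (j + 1))⁻¹ * w x ∂μ) (Set.Ici 0) ∧
    ∃ M : ℝ, ∀ t : ℝ, 0 ≤ t → ‖∫ x, k x * ((t ^ j : ℝ) : ℂ) *
      ((γ x - e * (t : ℂ)) ^ (j + 1))⁻¹ * w x ∂μ‖ ≤ M := by
  have hbound : ∀ t ∈ Set.Ici (0:ℝ), ∀ᵐ x ∂μ, ‖k x * ((t ^ j : ℝ) : ℂ) *
      ((γ x - e * (t : ℂ)) ^ (j + 1))⁻¹ * w x‖ ≤ ‖k x‖ * (c ^ (j + 1))⁻¹ := by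
    intro t ht
    filter_upwards [h] with x hx
    obtain ⟨h1, h2⟩ := hx t ht
    have ht0 : (0:ℝ) ≤ t := ht
    rw [norm_mul, hw1, mul_one, norm_mul, norm_mul, mul_assoc, norm_inv, norm_pow,
      Complex.norm_real, Real.norm_of_nonneg (pow_nonneg ht0 j)]
    refine mul_le_mul_of_nonneg_left ?_ (norm_nonneg _)
    have hN : 0 < ‖γ x - e * (t : ℂ)‖ := hc.trans_le h1
    rw [← div_eq_mul_inv, div_le_iff₀ (by positivity), inv_mul_eq_div, le_div_iff₀ (by positivity)]
    calc t ^ j * c ^ (j + 1) = (c * t) ^ j * c := by ring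
      _ ≤ ‖γ x - e * (t : ℂ)‖ ^ j * ‖γ x - e * (t : ℂ)‖ := by gcongr
      _ = _ := by ring
  have hint : Integrable (fun x => ‖k x‖ * (c ^ (j + 1))⁻¹) μ := hk.norm.mul_const _
  refine ⟨continuousOn_of_dominated (fun t _ => ?_) hbound hint ?_,
    ∫ x, ‖k x‖ * (c ^ (j + 1))⁻¹ ∂μ, fun t ht => norm_integral_le_of_norm_le hint (hbound t ht)⟩
  · exact ((hk.aestronglyMeasurable.mul_const _).mul
      ((((hγ.sub_const _).pow_const _).inv).aestronglyMeasurable)).mul hw.aestronglyMeasurable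
  · filter_upwards [h] with x hx
    refine ContinuousOn.mul (ContinuousOn.mul (by fun_prop) ?_) continuousOn_const
    refine ContinuousOn.inv₀ (by fun_prop) fun t ht => pow_ne_zero _ ?_
    exact norm_pos_iff.1 (hc.trans_le (hx t ht).1)

theorem measurable_mlKer (a b : ℝ) : Measurable (mlKer a b) := by
  unfold mlKer
  exact (Complex.measurable_exp.comp (measurable_id.pow_const _)).mul (measurable_id.pow_const _)

theorem norm_mlKer (a b : ℝ) {ρ θ : ℝ} (hρ : 0 < ρ) (hθ : |θ| < Real.pi) :
    ‖mlKer a b ((ρ : ℂ) * Complex.exp (Complex.I * θ))‖ =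
      Real.exp (ρ ^ (1 / a) * Real.cos (θ / a)) * ρ ^ ((1 - b) / a) := by
  have hlog : Complex.log ((ρ : ℂ) * Complex.exp (Complex.I * θ)) =
      (Real.log ρ : ℂ) + θ * Complex.I := by
    rw [Complex.log_ofReal_mul hρ (Complex.exp_ne_zero _), mul_comm Complex.I, Complex.log_exp]
    · simpa using (abs_lt.1 hθ).1
    · simpa using (abs_lt.1 hθ).2.le
  have hne : (ρ : ℂ) * Complex.exp (Complex.I * θ) ≠ 0 :=
    mul_ne_zero (Complex.ofReal_ne_zero.2 hρ.ne') (Complex.exp_ne_zero _)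
  rw [mlKer, norm_mul, Complex.norm_exp, Complex.cpow_def_of_ne_zero hne,
    Complex.cpow_def_of_ne_zero hne, Complex.norm_exp, hlog, Complex.exp_re,
    Real.rpow_def_of_pos hρ, Real.rpow_def_of_pos hρ]
  simp only [Complex.add_re, Complex.add_im, Complex.ofReal_re, Complex.ofReal_im, Complex.mul_re, Complex.mul_im, Complex.I_re,
    Complex.I_im]
  congr 4 <;> ring_nf

theorem integrableOn_mlKer_ray {a : ℝ} (b : ℝ) {θ : ℝ} (ha : 0 < a) (hθ : |θ| < Real.pi)
    (hcos : Real.cos (θ / a) < 0) :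
    IntegrableOn (fun ρ : ℝ => mlKer a b ((ρ : ℂ) * Complex.exp (Complex.I * θ)))
      (Set.Ioi 1) := by
  have hint : IntegrableOn (fun x : ℝ => x ^ |(1 - b) / a| *
      Real.exp (-(-Real.cos (θ / a)) * x ^ (1 / a))) (Set.Ioi 1) :=
    (integrableOn_rpow_mul_exp_neg_mul_rpow (by linarith [abs_nonneg ((1 - b) / a)])
      (by positivity) (by linarith)).mono_set (Set.Ioi_subset_Ioi zero_le_one)
  refine Integrable.mono' hint ?_ ?_
  · exact ((measurable_mlKer a b).comp
      (Complex.measurable_ofReal.mul_const _)).aestronglyMeasurable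
  · filter_upwards [ae_restrict_mem measurableSet_Ioi] with ρ hρ
    have hρ1 : (1:ℝ) < ρ := hρ
    rw [norm_mlKer a b (by linarith) hθ, mul_comm, neg_neg, mul_comm (Real.cos _)]
    gcongr
    · exact hρ1.le
    · exact le_abs_self _

theorem integrableOn_mlKer_arc (a b : ℝ) {ω : ℝ} (hω : ω < Real.pi) :
    IntegrableOn (fun θ : ℝ => mlKer a b (Complex.exp (Complex.I * θ))) (Set.Ioc (-ω) ω) := by
  refine Measure.integrableOn_of_bounded (M := Real.exp 1) measure_Ioc_lt_top.ne ?_ ?_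
  · exact ((measurable_mlKer a b).comp (by fun_prop)).aestronglyMeasurable
  · filter_upwards [ae_restrict_mem measurableSet_Ioc] with θ hθ
    have := norm_mlKer a b one_pos ((abs_le.2 ⟨hθ.1.le, hθ.2⟩).trans_lt hω)
    simp only [Complex.ofReal_one, one_mul, Real.one_rpow, mul_one] at this
    rw [this]
    exact Real.exp_le_exp.2 (Real.cos_le_one _)

theorem continuousOn_bounded_contourIntegral {α φ ω : ℝ} (β : ℝ) (j : ℕ) (hα0 : 0 < α)
    (hφ : |φ| ≤ Real.pi) (hω1 : α * Real.pi / 2 < ω) (hω2 : ω < |φ|)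
    (hω3 : ω < α * Real.pi) (hω4 : ω < Real.pi) :
    ContinuousOn (fun t : ℝ => contourIntegral ω (fun z => mlKer α β z * ((t ^ j : ℝ) : ℂ) *
      ((z - Complex.exp (Complex.I * φ) * (t : ℂ)) ^ (j + 1))⁻¹)) (Set.Ici 0) ∧
    ∃ M : ℝ, ∀ t : ℝ, 0 ≤ t → ‖contourIntegral ω (fun z => mlKer α β z * ((t ^ j : ℝ) : ℂ) *
      ((z - Complex.exp (Complex.I * φ) * (t : ℂ)) ^ (j + 1))⁻¹)‖ ≤ M := by
  have hω0 : 0 < ω := lt_trans (by positivity) hω1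
  obtain ⟨c, hc, hsep⟩ := exists_pos_le_norm_sub hφ hω0.le hω2 hω4
  have hcos : Real.cos (ω / α) < 0 := by
    refine Real.cos_neg_of_pi_div_two_lt_of_lt ?_ ?_
    · rw [lt_div_iff₀ hα0]; linarith
    · rw [div_lt_iff₀ hα0]; nlinarith [Real.pi_pos]
  have hneg : -Complex.I * (ω : ℂ) = Complex.I * ((-ω : ℝ) : ℂ) := by push_cast; ring
  have hn1 : ∀ θ : ℝ, ‖Complex.exp (Complex.I * θ)‖ = 1 := fun θ => by
    rw [mul_comm, Complex.norm_exp_ofReal_mul_I]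
  have hray : ∀ θ : ℝ, |θ| = ω → _ := fun θ hθ =>
    continuousOn_bounded_integral_cauchy_kernel (μ := volume.restrict (Set.Ioi 1))
      (γ := fun ρ : ℝ => (ρ : ℂ) * Complex.exp (Complex.I * θ))
      (w := fun _ => Complex.exp (Complex.I * θ)) (e := Complex.exp (Complex.I * φ))
      (k := fun ρ : ℝ => mlKer α β ((ρ : ℂ) * Complex.exp (Complex.I * θ))) j hc (by fun_prop)
      (integrableOn_mlKer_ray β hα0 (hθ.trans_lt hω4) (by
        rw [← Real.cos_abs, abs_div, hθ, abs_of_pos hα0]; exact hcos))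
      measurable_const (fun _ => hn1 θ) (by
        filter_upwards [ae_restrict_mem measurableSet_Ioi] with ρ hρ t ht
        exact hsep θ ρ t hθ.le (le_of_lt hρ) ht)
  obtain ⟨c1, M1, b1⟩ := hray ω (abs_of_pos hω0)
  obtain ⟨c2, M2, b2⟩ := hray (-ω) (by rw [abs_neg, abs_of_pos hω0])
  obtain ⟨c3, M3, b3⟩ :=
    continuousOn_bounded_integral_cauchy_kernel (μ := volume.restrict (Set.Ioc (-ω) ω))
      (γ := fun θ : ℝ => Complex.exp (Complex.I * θ))
      (w := fun θ : ℝ => Complex.exp (Complex.I * θ)) (e := Complex.exp (Complex.I * φ))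
      (k := fun θ : ℝ => mlKer α β (Complex.exp (Complex.I * θ))) j hc (by fun_prop)
      (integrableOn_mlKer_arc α β hω4) (by fun_prop) hn1 (by
        filter_upwards [ae_restrict_mem measurableSet_Ioc] with θ hθ t ht
        simpa using hsep θ 1 t (abs_le.2 ⟨hθ.1.le, hθ.2⟩) le_rfl ht)
  simp only [contourIntegral, hneg, intervalIntegral.integral_of_le (neg_le_self hω0.le)]
  refine ⟨(c1.sub c2).add (continuousOn_const.mul c3), M1 + M2 + M3, fun t ht => ?_⟩
  refine (norm_add_le _ _).trans (add_le_add ((norm_sub_le _ _).trans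
    (add_le_add (b1 t ht) (b2 t ht))) ?_)
  rw [norm_mul, Complex.norm_I, one_mul]
  exact b3 t ht

theorem integrableOn_oscillatory_cutoff {φ₀ : ℝ → ℝ} (hsmooth : ContDiff ℝ (⊤ : ℕ∞) φ₀)
    (hone : ∀ r ∈ Set.Icc (-1:ℝ) 1, φ₀ r = 1)
    (hsupp : Function.support φ₀ ⊆ Set.Icc (-2:ℝ) 2)
    {a : ℝ} (ha : a < -1) (m : ℕ) (ε : ℝ) :
    IntegrableOn (fun r : ℝ => Complex.exp ((ε : ℂ) * Complex.I * r) * ((r ^ (a + m) : ℝ) : ℂ) *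
      ((iteratedDeriv m (fun t => 1 - φ₀ t) r : ℝ) : ℂ)) (Set.Ioi 0) := by
  have hcont : Continuous (iteratedDeriv m (fun t => 1 - φ₀ t)) :=
    ContDiff.continuous_iteratedDeriv m (contDiff_const.sub hsmooth)
      (by exact_mod_cast le_top)
  have hzero : ∀ r ∈ Set.Ioo (-1:ℝ) 1, iteratedDeriv m (fun t => 1 - φ₀ t) r = 0 := by
    intro r hr
    have : Set.EqOn (fun t => 1 - φ₀ t) (fun _ => (0:ℝ)) (Set.Ioo (-1:ℝ) 1) := fun t ht => by
      simp [hone t (Set.Ioo_subset_Icc_self ht)]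
    rw [this.iteratedDeriv_of_isOpen isOpen_Ioo m hr, iteratedDeriv_const]
    simp
  have hfar : ∀ r ∈ Set.Ioi (2:ℝ),
      iteratedDeriv m (fun t => 1 - φ₀ t) r = if m = 0 then 1 else 0 := by
    intro r hr
    have : Set.EqOn (fun t => 1 - φ₀ t) (fun _ => (1:ℝ)) (Set.Ioi (2:ℝ)) := fun t ht => by
      have : φ₀ t = 0 := by
        by_contra hne
        exact absurd (hsupp hne).2 (not_le.2 ht)
      simp [this]
    rw [this.iteratedDeriv_of_isOpen isOpen_Ioi m hr, iteratedDeriv_const]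
  obtain ⟨C, hC⟩ := (isCompact_Icc (a := (1:ℝ)) (b := 2)).exists_bound_of_continuousOn
    (f := fun r => r ^ m * iteratedDeriv m (fun t => 1 - φ₀ t) r)
    ((continuous_pow m).mul hcont).continuousOn
  have hbd : ∀ r : ℝ, 1 ≤ r →
      ‖r ^ m * iteratedDeriv m (fun t => 1 - φ₀ t) r‖ ≤ max C 1 := by
    intro r hr
    rcases le_or_gt r 2 with h | h
    · exact (hC r ⟨hr, h⟩).trans (le_max_left _ _)
    · refine le_trans ?_ (le_max_right _ _)
      rw [hfar r h]
      split_ifs with hm <;> simp [hm]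
  rw [← Set.Ioo_union_Ici_eq_Ioi zero_lt_one]
  refine IntegrableOn.union ?_ ?_
  · refine (integrableOn_zero (α := ℝ) (ε' := ℂ)).congr_fun (fun r hr => ?_) measurableSet_Ioo
    simp [hzero r ⟨by linarith [hr.1], hr.2⟩]
  · rw [integrableOn_Ici_iff_integrableOn_Ioi]
    refine Integrable.mono' ((integrableOn_Ioi_rpow_of_lt ha one_pos).const_mul (max C 1)) ?_ ?_
    · refine Measurable.aestronglyMeasurable ?_
      have := hcont.measurable
      fun_prop
    · filter_upwards [ae_restrict_mem measurableSet_Ioi] with r hr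
      have hr1 : (1:ℝ) < r := hr
      have hr0 : (0:ℝ) < r := by linarith
      have hexp : ‖Complex.exp ((ε : ℂ) * Complex.I * r)‖ = 1 := by
        rw [show (ε : ℂ) * Complex.I * r = ((ε * r : ℝ) : ℂ) * Complex.I by push_cast; ring,
          Complex.norm_exp_ofReal_mul_I]
      rw [norm_mul, norm_mul, hexp, one_mul, Complex.norm_real, Complex.norm_real, ← norm_mul,
        Real.rpow_add hr0, Real.rpow_natCast, mul_assoc, norm_mul,
        Real.norm_of_nonneg (Real.rpow_nonneg hr0.le a), mul_comm]
      exact mul_le_mul_of_nonneg_right (hbd r hr1.le) (Real.rpow_nonneg hr0.le a)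

theorem contourIntegral_congr {ω : ℝ} {F G : ℂ → ℂ} (h : ∀ z, z ≠ 0 → F z = G z) :
    contourIntegral ω F = contourIntegral ω G := by
  have hray : ∀ v : ℂ, ∀ ρ ∈ Set.Ioi (1:ℝ), F ((ρ : ℂ) * Complex.exp v) * Complex.exp v =
      G ((ρ : ℂ) * Complex.exp v) * Complex.exp v := fun v ρ hρ => by
    rw [h _ (mul_ne_zero (Complex.ofReal_ne_zero.2 (zero_lt_one.trans hρ).ne')
      (Complex.exp_ne_zero _))]
  unfold contourIntegral
  rw [setIntegral_congr_fun measurableSet_Ioi (hray _),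
    setIntegral_congr_fun measurableSet_Ioi (hray _)]
  simp only [h _ (Complex.exp_ne_zero _)]

theorem tendsto_integral_mul_comp_rpow_div {g : ℝ → ℂ} {H : ℝ → ℂ} {s M : ℝ} (hs : 0 < s)
    (hg : IntegrableOn g (Set.Ioi 0)) (hH : ContinuousOn H (Set.Ici 0))
    (hM : ∀ t, 0 ≤ t → ‖H t‖ ≤ M) :
    Tendsto (fun R : ℝ => ∫ r in Set.Ioi (0:ℝ), g r * H (r ^ s / R ^ s)) atTop
      (𝓝 (H 0 * ∫ r in Set.Ioi (0:ℝ), g r)) := by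
  rw [mul_comm, ← integral_mul_const]
  refine tendsto_integral_filter_of_dominated_convergence (fun r => ‖g r‖ * M) ?_ ?_
    (hg.norm.mul_const M) ?_
  · filter_upwards [eventually_ge_atTop 0] with R hR
    refine hg.aestronglyMeasurable.mul (ContinuousOn.aestronglyMeasurable ?_ measurableSet_Ioi)
    refine hH.comp ((continuousOn_id.rpow_const fun r _ => Or.inr hs.le).div_const _) ?_
    intro r hr
    exact div_nonneg (Real.rpow_nonneg (le_of_lt hr) _) (Real.rpow_nonneg hR _)
  · filter_upwards [eventually_ge_atTop 0] with R hR
    filter_upwards [ae_restrict_mem measurableSet_Ioi] with r hr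
    rw [norm_mul]
    exact mul_le_mul_of_nonneg_left
      (hM _ (div_nonneg (Real.rpow_nonneg (le_of_lt hr) _) (Real.rpow_nonneg hR _)))
      (norm_nonneg _)
  · filter_upwards [ae_restrict_mem measurableSet_Ioi] with r hr
    refine Tendsto.const_mul _ ((hH 0 Set.self_mem_Ici).tendsto.comp ?_)
    refine tendsto_nhdsWithin_iff.2 ⟨(tendsto_rpow_atTop hs).const_div_atTop _, ?_⟩
    filter_upwards [eventually_ge_atTop 0] with R hR
    exact div_nonneg (Real.rpow_nonneg (le_of_lt hr) _) (Real.rpow_nonneg hR _)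

theorem stmt16 (n : ℕ) (hn : 1 ≤ n) (α β σ φ : ℝ)
    (hα0 : 0 < α) (hα2 : α < 2) (hβ : 0 < β) (hσ0 : 0 < σ)
    (hφ1 : -Real.pi < φ) (hφ2 : φ ≤ Real.pi) (hφα : α * Real.pi / 2 < |φ|) (ω : ℝ) (hω1 : α * Real.pi / 2 < ω) (hω2 : ω < |φ|) (hω3 : ω < α * Real.pi) (hω4 : ω < Real.pi) (φ₀ : ℝ → ℝ) (hcut_smooth : ContDiff ℝ (⊤ : ℕ∞) φ₀)
    (hcut_range : ∀ r, 0 ≤ φ₀ r ∧ φ₀ r ≤ 1)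
    (hcut_one : ∀ r ∈ Set.Icc (-1:ℝ) 1, φ₀ r = 1)
    (hcut_supp : Function.support φ₀ ⊆ Set.Icc (-2:ℝ) 2)
    (a : ℝ) (ha : a < -1) (m j : ℕ) (ε : ℝ) (hε : ε = 1 ∨ ε = -1) :
    (1 ≤ j →
      Tendsto (fun ξ : EuclideanSpace ℝ (Fin n) => Qpm n α β σ φ ω a φ₀ m j ε ξ)
        (Filter.comap (fun ξ : EuclideanSpace ℝ (Fin n) => ‖ξ‖) atTop) (𝓝 0)) ∧
    (j = 0 →
      Tendsto (fun ξ : EuclideanSpace ℝ (Fin n) => Qpm n α β σ φ ω a φ₀ m j ε ξ)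
        (Filter.comap (fun ξ : EuclideanSpace ℝ (Fin n) => ‖ξ‖) atTop)
        (𝓝 (contourIntegral ω (fun z =>
            Complex.exp (z ^ (((1 / α : ℝ)) : ℂ)) * z ^ ((((1 - β - α) / α : ℝ)) : ℂ)) *
          ∫ r in Set.Ioi (0:ℝ), Complex.exp ((ε : ℂ) * Complex.I * r) *
            ((r ^ (a + m) : ℝ) : ℂ) *
            ((iteratedDeriv m (fun t => 1 - φ₀ t) r : ℝ) : ℂ)))) := by
  have hφabs : |φ| ≤ Real.pi := abs_le.2 ⟨hφ1.le, hφ2⟩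
  obtain ⟨hH, M, hM⟩ := continuousOn_bounded_contourIntegral β j hα0 hφabs hω1 hω2 hω3 hω4
  have key := (tendsto_integral_mul_comp_rpow_div hσ0
    (integrableOn_oscillatory_cutoff hcut_smooth hcut_one hcut_supp ha m ε) hH hM).comp
    (tendsto_comap (f := fun ξ : EuclideanSpace ℝ (Fin n) => ‖ξ‖))
  have hQ : ∀ ξ : EuclideanSpace ℝ (Fin n), Qpm n α β σ φ ω a φ₀ m j ε ξ = _ := fun ξ =>
    setIntegral_congr_fun (g := fun r : ℝ => Complex.exp ((ε : ℂ) * Complex.I * r) *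
      ((r ^ (a + m) : ℝ) : ℂ) * ((iteratedDeriv m (fun t => 1 - φ₀ t) r : ℝ) : ℂ) *
      contourIntegral ω (fun z => mlKer α β z * (((r ^ σ / ‖ξ‖ ^ σ) ^ j : ℝ) : ℂ) *
        ((z - Complex.exp (Complex.I * φ) * ((r ^ σ / ‖ξ‖ ^ σ : ℝ) : ℂ)) ^ (j + 1))⁻¹))
      measurableSet_Ioi fun r hr => by
        have hpow : ∀ x : ℝ, 0 ≤ x → x ^ ((j : ℝ) * σ) = (x ^ σ) ^ j := fun x hx => by
          rw [mul_comm, Real.rpow_mul hx, Real.rpow_natCast]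
        simp only [hpow r (le_of_lt hr), hpow _ (norm_nonneg ξ), div_pow]
  simp only [hQ]
  refine ⟨fun hj => ?_, fun hj => ?_⟩
  · refine key.trans_eq ?_
    simp [zero_pow (Nat.one_le_iff_ne_zero.1 hj), contourIntegral]
  · subst hj
    refine key.trans_eq ?_
    congr 2
    refine contourIntegral_congr fun z hz => ?_
    rw [show (1 - β - α) / α = (1 - β) / α - 1 by field_simp, Complex.ofReal_sub,
      Complex.cpow_sub _ _ hz, mlKer]
    simp [div_eq_mul_inv, mul_assoc]
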